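/- arXiv:1405.2487 — 2 statements merged into one kernel-verified Lean document; each statement's English description precedes it below -/
import Mathlib

section
/- Let f: (0,∞) → ℝ be strictly decreasing with f(τ) → 0 as τ → ∞ (hence f > 0 everywhere), and assume f is integrable on (0,1). Then for every γ > 0 the improper integral lim_{R→∞} ∫_0^R sin(γτ) f(τ) dτ exists and is strictly positive. -/
open MeasureTheory Real Filter

noncomputable section

/-- An antitone function on `(0, ∞)` tending to `0` is nonnegative there. -/
theorem nonneg_of_antitoneOn_of_tendsto_zero {f : ℝ → ℝ} (hf : AntitoneOn f (Set.Ioi 0))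
    (hlim : Tendsto f atTop (nhds 0)) {x : ℝ} (hx : 0 < x) : 0 ≤ f x := by
  refine le_of_tendsto hlim ?_
  filter_upwards [eventually_ge_atTop x] with y hy
  exact hf hx (hx.trans_le hy) hy

/-- A function that is antitone on `(0, ∞)` and integrable near `0` is integrable on every bounded
subinterval of `[0, ∞)`. -/
theorem intervalIntegrable_of_antitoneOn_Ioi {f : ℝ → ℝ} (hf : AntitoneOn f (Set.Ioi 0))
    (hint : IntegrableOn f (Set.Ioo 0 1)) {a b : ℝ} (ha : 0 ≤ a) (hb : 0 ≤ b) :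
    IntervalIntegrable f volume a b := by
  have h01 : IntervalIntegrable f volume 0 1 :=
    (intervalIntegrable_iff_integrableOn_Ioo_of_le zero_le_one).2 hint
  have key : ∀ c : ℝ, 0 ≤ c → IntervalIntegrable f volume 0 c := by
    intro c hc
    rcases le_total c 1 with h | h
    · refine h01.mono_set ?_
      rw [Set.uIcc_of_le hc, Set.uIcc_of_le zero_le_one]
      exact Set.Icc_subset_Icc_right h
    · refine h01.trans (AntitoneOn.intervalIntegrable (hf.mono ?_))
      rw [Set.uIcc_of_le h]
      exact fun x hx => zero_lt_one.trans_le hx.1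
  exact (key a ha).symm.trans (key b hb)

/-- The absolute value of the integral of `sin (γ * τ) * f τ` over the `n`-th half-period. -/
def sinHalfPeriodIntegral (f : ℝ → ℝ) (γ : ℝ) (n : ℕ) : ℝ :=
  ∫ t in (0 : ℝ)..(π / γ), sin (γ * t) * f (t + n * (π / γ))

/-- On an interval of length at most `p` starting at `a > 0`, the integral of `sin (γ * τ) * f τ`
is at most `f a * p` in absolute value. -/
theorem abs_integral_sin_mul_le {f : ℝ → ℝ} (hf : AntitoneOn f (Set.Ioi 0))
    (hlim : Tendsto f atTop (nhds 0)) (γ : ℝ) {a b p : ℝ} (ha : 0 < a) (hab : a ≤ b)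
    (hbp : b - a ≤ p) : |∫ t in a..b, sin (γ * t) * f t| ≤ f a * p := by
  have h0 := nonneg_of_antitoneOn_of_tendsto_zero hf hlim ha
  have h : ‖∫ t in a..b, sin (γ * t) * f t‖ ≤ f a * |b - a| := by
    refine intervalIntegral.norm_integral_le_of_norm_le_const fun x hx => ?_
    rw [Set.uIoc_of_le hab] at hx
    have hx0 : 0 < x := ha.trans hx.1
    rw [norm_mul, Real.norm_eq_abs, Real.norm_eq_abs,
      abs_of_nonneg (nonneg_of_antitoneOn_of_tendsto_zero hf hlim hx0)]
    calc |sin (γ * x)| * f x ≤ 1 * f a :=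
          mul_le_mul (abs_sin_le_one _) (hf ha hx0 hx.1.le)
            (nonneg_of_antitoneOn_of_tendsto_zero hf hlim hx0) zero_le_one
      _ = f a := one_mul _
  rw [abs_of_nonneg (sub_nonneg.2 hab)] at h
  exact h.trans (mul_le_mul_of_nonneg_left hbp h0)

theorem integral_sin_mul_halfPeriod (f : ℝ → ℝ) {γ : ℝ} (hγ : 0 < γ) (n : ℕ) :
    ∫ t in (n * (π / γ))..((n + 1 : ℕ) * (π / γ)), sin (γ * t) * f t =
      (-1) ^ n * sinHalfPeriodIntegral f γ n := by
  have h := intervalIntegral.integral_comp_add_right (a := 0) (b := π / γ)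
    (fun t => sin (γ * t) * f t) (n * (π / γ))
  have e : π / γ + n * (π / γ) = (n + 1 : ℕ) * (π / γ) := by push_cast; ring
  rw [zero_add, e] at h
  rw [← h, sinHalfPeriodIntegral, ← intervalIntegral.integral_const_mul]
  refine intervalIntegral.integral_congr fun t _ => ?_
  have e' : γ * (t + n * (π / γ)) = γ * t + n * π := by field_simp
  simp only [e', sin_add_nat_mul_pi]
  ring

theorem sinHalfPeriodIntegral_succ_lt {f : ℝ → ℝ} (hf : StrictAntiOn f (Set.Ioi 0))
    (hint : IntegrableOn f (Set.Ioo 0 1)) {γ : ℝ} (hγ : 0 < γ) (n : ℕ) :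
    sinHalfPeriodIntegral f γ (n + 1) < sinHalfPeriodIntegral f γ n := by
  have hp : 0 < π / γ := div_pos pi_pos hγ
  have hi : ∀ m : ℕ, IntervalIntegrable (fun t => sin (γ * t) * f (t + m * (π / γ)))
      volume 0 (π / γ) := by
    intro m
    have hm : 0 ≤ m * (π / γ) := by positivity
    have h := (intervalIntegrable_of_antitoneOn_Ioi hf.antitoneOn hint hm
      (add_nonneg hp.le hm)).comp_add_right (m * (π / γ))
    rw [sub_self, add_sub_cancel_right] at h
    exact h.continuousOn_mul (by fun_prop)
  rw [← sub_pos, sinHalfPeriodIntegral, sinHalfPeriodIntegral,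
    ← intervalIntegral.integral_sub (hi n) (hi (n + 1))]
  refine intervalIntegral.intervalIntegral_pos_of_pos_on ((hi n).sub (hi (n + 1)))
    (fun t ht => ?_) hp
  have hs : 0 < sin (γ * t) := by
    refine sin_pos_of_pos_of_lt_pi (mul_pos hγ ht.1) ?_
    rw [mul_comm]
    exact (lt_div_iff₀ hγ).1 ht.2
  have ht0 : 0 < t + n * (π / γ) := add_pos_of_pos_of_nonneg ht.1 (by positivity)
  have hlt : t + n * (π / γ) < t + (n + 1 : ℕ) * (π / γ) := by
    push_cast
    linarith
  rw [← mul_sub]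
  exact mul_pos hs (sub_pos.2 (hf ht0 (ht0.trans hlt) hlt))

theorem tendsto_sinHalfPeriodIntegral {f : ℝ → ℝ} (hf : AntitoneOn f (Set.Ioi 0))
    (hlim : Tendsto f atTop (nhds 0)) {γ : ℝ} (hγ : 0 < γ) :
    Tendsto (sinHalfPeriodIntegral f γ) atTop (nhds 0) := by
  have hp : 0 < π / γ := div_pos pi_pos hγ
  have hb : Tendsto (fun n : ℕ => f (n * (π / γ)) * (π / γ)) atTop (nhds 0) := by
    simpa using (hlim.comp (tendsto_natCast_atTop_atTop.atTop_mul_const hp)).mul_const (π / γ)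
  refine squeeze_zero_norm' ?_ hb
  filter_upwards [eventually_gt_atTop 0] with n hn
  have h := abs_integral_sin_mul_le hf hlim γ (a := n * (π / γ)) (b := (n + 1 : ℕ) * (π / γ))
    (p := π / γ) (by positivity) (by push_cast; linarith) (by push_cast; linarith)
  rw [integral_sin_mul_halfPeriod f hγ, abs_mul, abs_pow, abs_neg, abs_one, one_pow, one_mul] at h
  exact h

/-- from the proof of Lemma 4: if `f : (0,∞) → ℝ` is strictly
decreasing with `f(τ) → 0` as `τ → ∞` and integrable on `(0,1)`, then for every `γ > 0`
the improper integral `∫_0^∞ sin(γτ) f(τ) dτ` exists and is strictly positive. -/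
theorem integral_sin_mul_antitone_pos (f : ℝ → ℝ)
    (hanti : StrictAntiOn f (Set.Ioi (0 : ℝ)))
    (hlim : Tendsto f atTop (nhds (0 : ℝ)))
    (hint : IntegrableOn f (Set.Ioo (0 : ℝ) 1)) :
    ∀ γ > (0 : ℝ), ∃ L : ℝ,
      Tendsto (fun R : ℝ => ∫ τ in (0 : ℝ)..R, Real.sin (γ * τ) * f τ) atTop (nhds L) ∧
      0 < L := by
  intro γ hγ
  have hf := hanti.antitoneOn
  have hp : 0 < π / γ := div_pos pi_pos hγ
  have hi : ∀ {a b : ℝ}, 0 ≤ a → 0 ≤ b →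
      IntervalIntegrable (fun t => sin (γ * t) * f t) volume a b := fun ha hb =>
    (intervalIntegrable_of_antitoneOn_Ioi hf hint ha hb).continuousOn_mul (by fun_prop)
  have hdec : Antitone (sinHalfPeriodIntegral f γ) :=
    antitone_nat_of_succ_le fun n => (sinHalfPeriodIntegral_succ_lt hanti hint hγ n).le
  obtain ⟨L, hL⟩ := hdec.tendsto_alternating_series_of_tendsto_zero
    (tendsto_sinHalfPeriodIntegral hf hlim hγ)
  have hpartial : ∀ n : ℕ, ∑ i ∈ Finset.range n, (-1) ^ i * sinHalfPeriodIntegral f γ i =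
      ∫ t in (0 : ℝ)..(n * (π / γ)), sin (γ * t) * f t := by
    intro n
    have h := intervalIntegral.sum_integral_adjacent_intervals (n := n)
      (a := fun k : ℕ => (k : ℝ) * (π / γ)) (f := fun t => sin (γ * t) * f t) (μ := volume)
      fun k _ => hi (by positivity) (by positivity)
    simp only [integral_sin_mul_halfPeriod f hγ, Nat.cast_zero, zero_mul] at h
    exact h
  refine ⟨L, ?_, ?_⟩
  · have hfloor : Tendsto (fun R : ℝ => ⌊R / (π / γ)⌋₊) atTop atTop :=
      tendsto_nat_floor_atTop.comp (tendsto_id.atTop_div_const hp)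
    have hbound : Tendsto (fun R : ℝ => f (⌊R / (π / γ)⌋₊ * (π / γ)) * (π / γ)) atTop
        (nhds 0) := by
      simpa using (hlim.comp ((tendsto_natCast_atTop_atTop.comp hfloor).atTop_mul_const
        hp)).mul_const (π / γ)
    have htail : Tendsto (fun R : ℝ => ∫ t in (⌊R / (π / γ)⌋₊ * (π / γ))..R, sin (γ * t) * f t)
        atTop (nhds 0) := by
      refine squeeze_zero_norm' ?_ hbound
      filter_upwards [eventually_ge_atTop 0, hfloor.eventually_gt_atTop 0] with R hR hn
      have hle := (le_div_iff₀ hp).1 (Nat.floor_le (div_nonneg hR hp.le))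
      have hlt := (div_lt_iff₀ hp).1 (Nat.lt_floor_add_one (R / (π / γ)))
      exact abs_integral_sin_mul_le hf hlim γ (by positivity) hle (by linarith)
    have hsum := (hL.comp hfloor).add htail
    rw [add_zero] at hsum
    refine hsum.congr' ?_
    filter_upwards [eventually_ge_atTop 0] with R hR
    simp only [Function.comp_apply, hpartial]
    exact intervalIntegral.integral_add_adjacent_intervals (hi le_rfl (by positivity))
      (hi (by positivity) hR)
  · have h := hdec.alternating_series_le_tendsto hL 1
    have hlt := sinHalfPeriodIntegral_succ_lt hanti hint hγ 0
    simp only [Nat.mul_one, Finset.sum_range_succ, Finset.sum_range_zero] at h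
    norm_num at h hlt
    linarith
end
end

section
/- Let α(x) = sin⁴(|x|)/(π²|x|⁴) for x ∈ ℝ³. Then α is a probability density on ℝ³, and its Fourier transform (characteristic function) α̂(k) = ∫_{ℝ³} e^{−i(k,x)} α(x) dx is the radial function given by: α̂(k) = 1 − 3|k|/8 for |k| ≤ 2; α̂(k) = 2/|k| − 1 + |k|/8 for 2 ≤ |k| ≤ 4; and α̂(k) = 0 for |k| ≥ 4. -/
open MeasureTheory Real Filter
open scoped RealInnerProductSpace

noncomputable section

/-- The isotropic density `α(x) = sin⁴(|x|)/(π²|x|⁴)` on `ℝ³`. -/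
def exDensity (x : EuclideanSpace ℝ (Fin 3)) : ℝ :=
  Real.sin ‖x‖ ^ 4 / (π ^ 2 * ‖x‖ ^ 4)

/-- The piecewise function which is claimed to be the characteristic function of
`exDensity`. -/
def exChar (k : EuclideanSpace ℝ (Fin 3)) : ℝ :=
  if ‖k‖ ≤ 2 then 1 - 3 * ‖k‖ / 8
  else if ‖k‖ ≤ 4 then 2 / ‖k‖ - 1 + ‖k‖ / 8
  else 0

lemma laplace_one_sub_cos {t : ℝ} (ht : 0 < t) :
    IntegrableOn (fun r => (1 - cos r) * exp (-(t * r))) (Set.Ioi 0) ∧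
    ∫ r in Set.Ioi 0, (1 - cos r) * exp (-(t * r)) = 1 / (t * (1 + t ^ 2)) := by
  have h1 := integrableOn_exp_mul_complex_Ioi (a := (-t : ℂ)) (by simpa using ht) 0
  have h2 := integrableOn_exp_mul_complex_Ioi (a := (-t + Complex.I : ℂ)) (by simpa using ht) 0
  have e1 := integral_exp_mul_complex_Ioi (a := (-t : ℂ)) (by simpa using ht) 0
  have e2 := integral_exp_mul_complex_Ioi (a := (-t + Complex.I : ℂ)) (by simpa using ht) 0
  have key : ∀ r : ℝ, (1 - cos r) * exp (-(t * r)) =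
      RCLike.re (Complex.exp (-t * r) - Complex.exp ((-t + Complex.I) * r)) := by
    intro r
    simp [Complex.exp_re]
    ring
  simp_rw [key]
  refine ⟨(h1.fun_sub h2).re, ?_⟩
  rw [integral_re (h1.fun_sub h2), integral_sub h1 h2, e1, e2]
  simp [Complex.div_re, Complex.normSq_apply]
  field_simp
  ring

lemma lintegral_one_sub_cos_div_sq :
    ∫⁻ r in Set.Ioi (0:ℝ), ENNReal.ofReal ((1 - cos r) / r ^ 2) = ENNReal.ofReal (π / 2) := by
  have h1 : ∀ r ∈ Set.Ioi (0:ℝ), ENNReal.ofReal ((1 - cos r) / r ^ 2) =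
      ∫⁻ t in Set.Ioi (0:ℝ), ENNReal.ofReal (t * ((1 - cos r) * exp (-(t * r)))) := by
    intro r (hr : 0 < r)
    have := integral_rpow_mul_exp_neg_mul_Ioi (a := 2) two_pos hr
    have e : ∫ t in Set.Ioi (0:ℝ), t * ((1 - cos r) * exp (-(t * r))) = (1 - cos r) / r ^ 2 := by
      have e' : ∀ t ∈ Set.Ioi (0:ℝ), t * ((1 - cos r) * exp (-(t * r))) =
          (1 - cos r) * (t ^ ((2:ℝ) - 1) * exp (-(r * t))) := by
        intro t ht
        norm_num
        rw [mul_comm r t]; ring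
      rw [setIntegral_congr_fun measurableSet_Ioi e', integral_const_mul, this]
      simp
      norm_cast
    by_cases hc : cos r = 1
    · simp [hc]
    rw [← e, ofReal_integral_eq_lintegral_ofReal]
    · by_contra hn
      have := integral_undef hn
      rw [e] at this
      rw [div_eq_zero_iff] at this
      rcases this with h | h
      · exact hc (by linarith)
      · exact (pow_pos hr 2).ne' h
    · filter_upwards [self_mem_ae_restrict measurableSet_Ioi] with t (ht : 0 < t)
      have : 0 ≤ 1 - cos r := by linarith [cos_le_one r]
      positivity
  rw [setLIntegral_congr_fun measurableSet_Ioi h1, lintegral_lintegral_swap (by fun_prop)]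
  have h2 : ∀ t ∈ Set.Ioi (0:ℝ),
      ∫⁻ r in Set.Ioi (0:ℝ), ENNReal.ofReal (t * ((1 - cos r) * exp (-(t * r)))) =
        ENNReal.ofReal (1 + t ^ 2)⁻¹ := by
    intro t (ht : 0 < t)
    obtain ⟨hi, he⟩ := laplace_one_sub_cos ht
    rw [← ofReal_integral_eq_lintegral_ofReal (hi.const_mul t), integral_const_mul, he]
    · congr 1; field_simp
    · filter_upwards with r
      have : 0 ≤ 1 - cos r := by linarith [cos_le_one r]
      positivity
  rw [setLIntegral_congr_fun measurableSet_Ioi h2, ← ofReal_integral_eq_lintegral_ofReal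
    integrable_inv_one_add_sq.integrableOn]
  · simp
  · filter_upwards with r
    positivity

lemma integrableOn_one_sub_cos_div_sq :
    IntegrableOn (fun r : ℝ => (1 - cos r) / r ^ 2) (Set.Ioi 0) := by
  refine ⟨Measurable.aestronglyMeasurable (by fun_prop), ?_⟩
  rw [hasFiniteIntegral_iff_ofReal, lintegral_one_sub_cos_div_sq]
  · exact ENNReal.ofReal_lt_top
  · filter_upwards with r
    have : 0 ≤ 1 - cos r := by linarith [cos_le_one r]
    positivity

lemma integral_one_sub_cos_div_sq :
    ∫ r in Set.Ioi (0:ℝ), (1 - cos r) / r ^ 2 = π / 2 := by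
  rw [integral_eq_lintegral_of_nonneg_ae, lintegral_one_sub_cos_div_sq,
    ENNReal.toReal_ofReal (by positivity)]
  · filter_upwards with r
    have : 0 ≤ 1 - cos r := by linarith [cos_le_one r]
    positivity
  · exact integrableOn_one_sub_cos_div_sq.1

lemma one_sub_cos_mul_div_sq (a : ℝ) :
    IntegrableOn (fun r : ℝ => (1 - cos (a * r)) / r ^ 2) (Set.Ioi 0) ∧
    ∫ r in Set.Ioi (0:ℝ), (1 - cos (a * r)) / r ^ 2 = π / 2 * |a| := by
  rcases eq_or_ne a 0 with rfl | ha
  · simp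
  have ha' : 0 < |a| := abs_pos.2 ha
  have key : (fun r : ℝ => (1 - cos (a * r)) / r ^ 2) =
      fun r => |a| ^ 2 * ((1 - cos (|a| * r)) / (|a| * r) ^ 2) := by
    ext r
    have : cos (|a| * r) = cos (a * r) := by
      rcases abs_choice a with h | h <;> simp [h]
    rw [this, mul_pow]
    field_simp
  rw [key]
  constructor
  · have := (integrableOn_Ioi_comp_mul_left_iff (fun r => (1 - cos r) / r ^ 2) 0 ha').2
      (by simpa using integrableOn_one_sub_cos_div_sq)
    exact Integrable.const_mul this _
  · rw [integral_const_mul, integral_comp_mul_left_Ioi (fun r => (1 - cos r) / r ^ 2) 0 ha',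
      mul_zero, integral_one_sub_cos_div_sq, smul_eq_mul]
    field_simp

lemma cos_mul_sin_pow_four (a r : ℝ) : cos (a * r) * sin r ^ 4 =
    (-6 * (1 - cos (a * r)) + 4 * (1 - cos ((a + 2) * r)) + 4 * (1 - cos ((a - 2) * r))
      - (1 - cos ((a + 4) * r)) - (1 - cos ((a - 4) * r))) / 16 := by
  have h4 : sin r ^ 4 = (3 - 4 * cos (2 * r) + cos (4 * r)) / 8 := by
    rw [show 4 * r = 2 * (2 * r) by ring, cos_two_mul (2 * r), cos_two_mul r,
      show sin r ^ 4 = (sin r ^ 2) ^ 2 by ring, sin_sq]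
    ring
  rw [h4, add_mul, sub_mul, add_mul, sub_mul, cos_add, cos_sub, cos_add, cos_sub]
  ring

lemma cos_mul_sin_pow_four_div_sq (a : ℝ) :
    IntegrableOn (fun r : ℝ => cos (a * r) * sin r ^ 4 / r ^ 2) (Set.Ioi 0) ∧
    ∫ r in Set.Ioi (0:ℝ), cos (a * r) * sin r ^ 4 / r ^ 2 =
      π / 32 * (-6 * |a| + 4 * |a + 2| + 4 * |a - 2| - |a + 4| - |a - 4|) := by
  obtain ⟨i0, e0⟩ := one_sub_cos_mul_div_sq a
  obtain ⟨i1, e1⟩ := one_sub_cos_mul_div_sq (a + 2)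
  obtain ⟨i2, e2⟩ := one_sub_cos_mul_div_sq (a - 2)
  obtain ⟨i3, e3⟩ := one_sub_cos_mul_div_sq (a + 4)
  obtain ⟨i4, e4⟩ := one_sub_cos_mul_div_sq (a - 4)
  have key : (fun r : ℝ => cos (a * r) * sin r ^ 4 / r ^ 2) = fun r =>
      (-6 * ((1 - cos (a * r)) / r ^ 2) + 4 * ((1 - cos ((a + 2) * r)) / r ^ 2) +
        4 * ((1 - cos ((a - 2) * r)) / r ^ 2) - (1 - cos ((a + 4) * r)) / r ^ 2
        - (1 - cos ((a - 4) * r)) / r ^ 2) / 16 := by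
    ext r
    rw [cos_mul_sin_pow_four]
    ring
  have j1 := (i0.const_mul (-6)).fun_add (i1.const_mul 4)
  have j2 := j1.fun_add (i2.const_mul 4)
  have j3 := IntegrableOn.fun_sub j2 i3
  rw [key]
  refine ⟨Integrable.div_const (IntegrableOn.fun_sub j3 i4) _, ?_⟩
  rw [integral_div, integral_sub j3 i4, integral_sub j2 i3, integral_add j1 (i2.const_mul 4),
    integral_add (i0.const_mul (-6)) (i1.const_mul 4)]
  simp only [integral_const_mul, e0, e1, e2, e3, e4]
  ring

lemma integral_Ioi_mul_comp_sqrt (f : ℝ → ℝ) (t : ℝ) :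
    ∫ ρ in Set.Ioi (0:ℝ), ρ * f √(t ^ 2 + ρ ^ 2) = ∫ r in Set.Ioi |t|, r * f r := by
  have himg : (fun ρ : ℝ => √(t ^ 2 + ρ ^ 2)) '' Set.Ioi 0 = Set.Ioi |t| := by
    ext r
    simp only [Set.mem_image, Set.mem_Ioi]
    constructor
    · rintro ⟨ρ, hρ, rfl⟩
      exact lt_sqrt_of_sq_lt (by rw [sq_abs]; nlinarith)
    · intro hr
      have h0 := abs_nonneg t
      refine ⟨√(r ^ 2 - t ^ 2), sqrt_pos.2 ?_, ?_⟩
      · rw [← sq_abs t]; nlinarith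
      · rw [sq_sqrt (by rw [← sq_abs t]; nlinarith)]
        simpa using sqrt_sq (by linarith)
  have hinj : Set.InjOn (fun ρ : ℝ => √(t ^ 2 + ρ ^ 2)) (Set.Ioi 0) := by
    intro a (ha : 0 < a) b (hb : 0 < b) hab
    have := (sqrt_inj (by positivity) (by positivity)).1 hab
    nlinarith
  have hderiv : ∀ ρ ∈ Set.Ioi (0:ℝ), HasDerivWithinAt (fun ρ : ℝ => √(t ^ 2 + ρ ^ 2))
      (ρ / √(t ^ 2 + ρ ^ 2)) (Set.Ioi 0) ρ := by
    intro ρ (hρ : 0 < ρ)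
    have h := ((((hasDerivAt_id ρ).pow 2).const_add (t ^ 2)).sqrt (by simp; positivity))
    refine (h.congr_deriv ?_).hasDerivWithinAt
    simp
    field_simp
  rw [← himg, integral_image_eq_integral_abs_deriv_smul measurableSet_Ioi hderiv hinj]
  refine setIntegral_congr_fun measurableSet_Ioi fun ρ (hρ : 0 < ρ) => ?_
  have : 0 < √(t ^ 2 + ρ ^ 2) := by positivity
  simp only [smul_eq_mul]
  rw [abs_of_pos (by positivity)]
  field_simp

section

variable {E : Type*} [NormedAddCommGroup E] [InnerProductSpace ℝ E] [FiniteDimensional ℝ E]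
  [MeasurableSpace E] [BorelSpace E]

lemma measurePreserving_smul_add_orthogonal {u : E} (hu : ‖u‖ = 1) :
    MeasurePreserving (fun p : ℝ × (ℝ ∙ u)ᗮ => p.1 • u + (p.2 : E)) := by
  have h1 := (LinearIsometryEquiv.toSpanUnitSingleton (𝕜 := ℝ) u hu).measurePreserving
  have h2 := h1.prod (MeasurePreserving.id (volume : Measure (ℝ ∙ u)ᗮ))
  have h3 := WithLp.volume_preserving_toLp (ℝ ∙ u) (ℝ ∙ u)ᗮ
  have h4 := (ℝ ∙ u).orthogonalDecomposition.symm.measurePreserving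
  exact h4.comp (h3.comp h2)

lemma integral_norm_sq_add_of_finrank_eq_two (h2 : Module.finrank ℝ E = 2) (f : ℝ → ℝ) (t : ℝ) :
    ∫ y : E, f √(t ^ 2 + ‖y‖ ^ 2) = 2 * π * ∫ r in Set.Ioi |t|, r * f r := by
  have : Nontrivial E := Module.nontrivial_of_finrank_pos (R := ℝ) (by omega)
  rw [integral_fun_norm_addHaar volume (fun ρ => f √(t ^ 2 + ρ ^ 2)), h2, measureReal_def,
    InnerProductSpace.volume_ball_of_dim_even (k := 1) (by omega)]
  simp [integral_Ioi_mul_comp_sqrt, pi_nonneg]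
  ring

lemma integrable_indicator_abs_lt {f : ℝ → ℝ} (hf : Measurable f)
    (hfi : IntegrableOn (fun r => r ^ 2 * f r) (Set.Ioi 0)) :
    Integrable (fun p : ℝ × ℝ => (Set.Ioi |p.1|).indicator (fun r => r * f r) p.2)
      (volume.prod (volume.restrict (Set.Ioi 0))) := by
  have hm : Measurable (fun p : ℝ × ℝ => (Set.Ioi |p.1|).indicator (fun r => r * f r) p.2) := by
    simp only [Set.indicator_apply, Set.mem_Ioi]
    exact Measurable.ite (measurableSet_lt (by fun_prop) (by fun_prop)) (by fun_prop) (by fun_prop)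
  have hsec : ∀ r t : ℝ, (Set.Ioi |t|).indicator (fun r => r * f r) r =
      (Set.Ioo (-r) r).indicator (fun _ => r * f r) t := by
    intro r t
    simp [Set.indicator_apply, abs_lt]
  rw [integrable_prod_iff' hm.aestronglyMeasurable]
  simp only [hsec]
  constructor
  · filter_upwards with r
    rw [integrable_indicator_iff measurableSet_Ioo]
    exact integrableOn_const (by simp)
  · refine ((hfi.norm).const_mul 2).congr ?_
    filter_upwards [self_mem_ae_restrict measurableSet_Ioi] with r (hr : 0 < r)
    simp only [norm_indicator_eq_indicator_norm]
    rw [integral_indicator measurableSet_Ioo]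
    simp [abs_of_pos hr]
    rw [max_eq_left (by linarith)]
    ring

/-- The hat-box theorem: integrating a radial function against a function of one coordinate. -/
theorem integral_inner_mul_norm_of_finrank_eq_three (h3 : Module.finrank ℝ E = 3) {u : E}
    (hu : ‖u‖ = 1) {f : ℝ → ℝ} (hf : Measurable f)
    (hfi : IntegrableOn (fun r => r ^ 2 * f r) (Set.Ioi 0)) {g : ℝ → ℂ} (hg : Continuous g)
    {C : ℝ} (hC : ∀ t, ‖g t‖ ≤ C) :
    ∫ x : E, g ⟪u, x⟫ * f ‖x‖ =
      2 * π * ∫ r in Set.Ioi (0:ℝ), (r * f r : ℝ) * ∫ t in -r..r, g t := by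
  have : Nontrivial E := Module.nontrivial_of_finrank_pos (R := ℝ) (by omega)
  have hu0 : u ≠ 0 := fun h => by simp [h] at hu
  have : Fact (Module.finrank ℝ E = 2 + 1) := ⟨h3⟩
  have hF2 : Module.finrank ℝ (ℝ ∙ u)ᗮ = 2 := Submodule.finrank_orthogonal_span_singleton hu0
  have hmp := measurePreserving_smul_add_orthogonal hu
  have hint : Integrable (fun x : E => g ⟪u, x⟫ * f ‖x‖) := by
    have h : Integrable (fun x : E => f ‖x‖) := by
      rw [integrable_fun_norm_addHaar, h3]
      simpa using hfi
    refine h.ofReal.bdd_mul (c := C) (by fun_prop) ?_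
    filter_upwards with x using hC _
  have hinner : ∀ p : ℝ × (ℝ ∙ u)ᗮ, ⟪u, p.1 • u + (p.2 : E)⟫ = p.1 := by
    intro p
    rw [inner_add_right, inner_smul_right, real_inner_self_eq_norm_sq, hu,
      Submodule.mem_orthogonal_singleton_iff_inner_right.1 p.2.2]
    simp
  have hnorm : ∀ p : ℝ × (ℝ ∙ u)ᗮ, ‖p.1 • u + (p.2 : E)‖ = √(p.1 ^ 2 + ‖p.2‖ ^ 2) := by
    intro p
    rw [eq_comm, sqrt_eq_iff_mul_self_eq (by positivity) (by positivity),
      norm_add_sq_eq_norm_sq_add_norm_sq_real]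
    · simp [norm_smul, hu, sq]
    · rw [inner_smul_left, Submodule.mem_orthogonal_singleton_iff_inner_right.1 p.2.2]
      simp
  have hint' := hmp.integrable_comp_of_integrable hint
  simp only [Function.comp_def, hinner, hnorm] at hint'
  have hswap : Integrable (Function.uncurry fun t r : ℝ =>
      g t * ((Set.Ioi |t|).indicator (fun r => r * f r) r : ℝ))
      (volume.prod (volume.restrict (Set.Ioi 0))) := by
    refine (integrable_indicator_abs_lt hf hfi).ofReal.bdd_mul (c := C)
      (f := fun p : ℝ × ℝ => g p.1) (by fun_prop) ?_
    filter_upwards with p using hC _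
  calc ∫ x : E, g ⟪u, x⟫ * f ‖x‖
      = ∫ p : ℝ × (ℝ ∙ u)ᗮ, g p.1 * f √(p.1 ^ 2 + ‖p.2‖ ^ 2) := by
        rw [← hmp.map_eq, integral_map hmp.measurable.aemeasurable
          (by rw [hmp.map_eq]; exact hint.1)]
        simp only [hinner, hnorm]
    _ = ∫ t : ℝ, g t * ((2 * π * ∫ r in Set.Ioi |t|, r * f r : ℝ) : ℂ) := by
        rw [Measure.volume_eq_prod, integral_prod _ hint']
        congr with t
        simp only
        rw [integral_const_mul, integral_complex_ofReal, integral_norm_sq_add_of_finrank_eq_two hF2]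
    _ = 2 * π * ∫ t : ℝ, ∫ r in Set.Ioi 0,
          g t * ((Set.Ioi |t|).indicator (fun r => r * f r) r : ℝ) := by
        rw [← integral_const_mul]
        congr with t
        rw [integral_const_mul, integral_complex_ofReal, setIntegral_indicator measurableSet_Ioi,
          Set.inter_eq_self_of_subset_right (Set.Ioi_subset_Ioi (abs_nonneg t))]
        push_cast
        ring
    _ = _ := by
        rw [integral_integral_swap hswap]
        congr 1
        refine setIntegral_congr_fun measurableSet_Ioi fun r (hr : 0 < r) => ?_
        have hsec : ∀ t : ℝ, g t * ((Set.Ioi |t|).indicator (fun r => r * f r) r : ℝ) =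
            (Set.Ioo (-r) r).indicator (fun t => (r * f r : ℝ) * g t) t := by
          intro t
          by_cases h : |t| < r
          · simp [abs_lt.1 h, h, mul_comm]
          · have h' := h
            rw [abs_lt] at h'
            simp [h, h']
        simp only [hsec]
        rw [integral_indicator measurableSet_Ioo, integral_const_mul,
          intervalIntegral.integral_of_le (by linarith), integral_Ioc_eq_integral_Ioo]

end

lemma hasDerivAt_mul_abs_self (x : ℝ) : HasDerivAt (fun x : ℝ => x * |x| / 2) |x| x := by
  rcases lt_trichotomy x 0 with hx | rfl | hx
  · refine (((hasDerivAt_id x).mul (hasDerivAt_abs_neg hx)).div_const 2).congr_deriv ?_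
    simp [abs_of_neg hx]
  · rw [hasDerivAt_iff_tendsto_slope]
    have h : Tendsto (fun x : ℝ => |x| / 2) (nhdsWithin 0 {0}ᶜ) (nhds |0|) :=
      tendsto_nhdsWithin_of_tendsto_nhds (by
        simpa using (continuous_abs.div_const (2:ℝ)).tendsto (0:ℝ))
    refine h.congr' ?_
    filter_upwards [self_mem_nhdsWithin] with y hy
    have hy' : y ≠ 0 := hy
    simp [slope_def_field]
    field_simp
  · refine (((hasDerivAt_id x).mul (hasDerivAt_abs_pos hx)).div_const 2).congr_deriv ?_
    simp [abs_of_pos hx]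

lemma mul_integral_abs_mul_add (κ c : ℝ) :
    κ * ∫ s in (0:ℝ)..1, |κ * s + c| = ((κ + c) * |κ + c| - c * |c|) / 2 := by
  rw [intervalIntegral.mul_integral_comp_mul_add (f := fun x => |x|),
    intervalIntegral.integral_eq_sub_of_hasDerivAt (fun x _ => hasDerivAt_mul_abs_self x)
      (continuous_abs.intervalIntegrable _ _)]
  simp
  ring

lemma integral_interval_exp_neg (κ r : ℝ) :
    ∫ t in -r..r, Complex.exp (-(Complex.I * (κ * t : ℝ))) =
      ((2 * r * ∫ s in (0:ℝ)..1, cos (κ * s * r) : ℝ) : ℂ) := by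
  have hg : Continuous fun t : ℝ => Complex.exp (-(Complex.I * (κ * t : ℝ))) := by fun_prop
  have hneg : ∫ t in -r..0, Complex.exp (-(Complex.I * (κ * t : ℝ))) =
      ∫ t in (0:ℝ)..r, Complex.exp (-(Complex.I * (κ * (-t) : ℝ))) := by
    rw [intervalIntegral.integral_comp_neg
      (fun t : ℝ => Complex.exp (-(Complex.I * (κ * t : ℝ))))]
    simp
  rw [← intervalIntegral.integral_add_adjacent_intervals (b := 0) (hg.intervalIntegrable _ _)
    (hg.intervalIntegrable _ _), hneg, ← intervalIntegral.integral_add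
    (Continuous.intervalIntegrable (by fun_prop) _ _) (hg.intervalIntegrable _ _)]
  have hcos : ∀ t : ℝ, Complex.exp (-(Complex.I * (κ * (-t) : ℝ))) +
      Complex.exp (-(Complex.I * (κ * t : ℝ))) = ((2 * cos (κ * t) : ℝ) : ℂ) := by
    intro t
    push_cast
    rw [Complex.two_cos]
    congr 2 <;> ring
  have hscale := intervalIntegral.mul_integral_comp_mul_left (a := 0) (b := 1)
    (f := fun t => cos (κ * t)) r
  simp only [hcos]
  rw [intervalIntegral.integral_ofReal, intervalIntegral.integral_const_mul, mul_assoc]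
  simp only [mul_zero, mul_one] at hscale
  rw [← hscale]
  simp only [mul_assoc, mul_comm r]

lemma integral_integral_cos_mul_sin_pow_four (κ : ℝ) :
    ∫ r in Set.Ioi (0:ℝ), ∫ s in (0:ℝ)..1, cos (κ * s * r) * sin r ^ 4 / r ^ 2 =
      ∫ s in (0:ℝ)..1, π / 32 * (-6 * |κ * s| + 4 * |κ * s + 2| + 4 * |κ * s - 2|
        - |κ * s + 4| - |κ * s - 4|) := by
  simp only [intervalIntegral.integral_of_le zero_le_one]
  rw [integral_integral_swap]
  · simp only [(cos_mul_sin_pow_four_div_sq _).2]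
  · have h0 := (cos_mul_sin_pow_four_div_sq 0).1
    simp only [zero_mul, cos_zero, one_mul] at h0
    have h1 : Integrable (fun _ : ℝ => (1:ℝ)) (volume.restrict (Set.Ioc (0:ℝ) 1)) :=
      integrable_const _
    have h2 := (Integrable.mul_prod h0 h1).bdd_mul (c := 1)
      (f := fun p : ℝ × ℝ => cos (κ * p.2 * p.1)) (by fun_prop)
      (by filter_upwards with p using abs_cos_le_one _)
    refine h2.congr ?_
    filter_upwards with p
    simp [Function.uncurry, mul_div_assoc]

lemma exDensity_char_eq_integral (k : EuclideanSpace ℝ (Fin 3)) :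
    ∫ x : EuclideanSpace ℝ (Fin 3),
      Complex.exp (-(Complex.I * (⟪k, x⟫ : ℝ))) * (exDensity x : ℝ) =
    ((4 / π * ∫ s in (0:ℝ)..1, π / 32 * (-6 * |‖k‖ * s| + 4 * |‖k‖ * s + 2|
      + 4 * |‖k‖ * s - 2| - |‖k‖ * s + 4| - |‖k‖ * s - 4|) : ℝ) : ℂ) := by
  obtain ⟨u, hu, hk⟩ : ∃ u : EuclideanSpace ℝ (Fin 3), ‖u‖ = 1 ∧ k = ‖k‖ • u := by
    rcases eq_or_ne k 0 with rfl | hk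
    · obtain ⟨u, hu⟩ := exists_norm_eq (EuclideanSpace ℝ (Fin 3)) zero_le_one
      exact ⟨u, hu, by simp⟩
    · have : ‖k‖ ≠ 0 := norm_ne_zero_iff.2 hk
      exact ⟨‖k‖⁻¹ • k, by simp [norm_smul, this], by simp [smul_smul, this]⟩
  set κ := ‖k‖
  have hf : Measurable fun r : ℝ => sin r ^ 4 / (π ^ 2 * r ^ 4) := by fun_prop
  have hfi : IntegrableOn (fun r : ℝ => r ^ 2 * (sin r ^ 4 / (π ^ 2 * r ^ 4))) (Set.Ioi 0) := by
    refine IntegrableOn.congr_fun ((cos_mul_sin_pow_four_div_sq 0).1.div_const (π ^ 2)) ?_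
      measurableSet_Ioi
    intro r (hr : 0 < r)
    simp
    field_simp
  have hmain := integral_inner_mul_norm_of_finrank_eq_three
    (E := EuclideanSpace ℝ (Fin 3)) (by simp) hu hf hfi
    (g := fun t : ℝ => Complex.exp (-(Complex.I * (κ * t : ℝ)))) (by fun_prop) (C := 1)
    (fun t => by simp [Complex.norm_exp])
  rw [hk]
  simp only [real_inner_smul_left, exDensity]
  rw [hmain, ← integral_integral_cos_mul_sin_pow_four]
  simp only [integral_interval_exp_neg, ← Complex.ofReal_mul]
  rw [integral_complex_ofReal]
  norm_cast
  rw [← integral_const_mul, ← integral_const_mul]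
  refine setIntegral_congr_fun measurableSet_Ioi fun r (hr : 0 < r) => ?_
  simp only [mul_div_assoc, intervalIntegral.integral_mul_const]
  field_simp
  ring

lemma four_div_pi_mul_integral_eq_exChar (k : EuclideanSpace ℝ (Fin 3)) :
    4 / π * ∫ s in (0:ℝ)..1, π / 32 * (-6 * |‖k‖ * s| + 4 * |‖k‖ * s + 2|
      + 4 * |‖k‖ * s - 2| - |‖k‖ * s + 4| - |‖k‖ * s - 4|) = exChar k := by
  rcases eq_or_ne k 0 with rfl | hk
  · norm_num [exChar]
    field_simp
    norm_num
  have hpos : 0 < ‖k‖ := norm_pos_iff.2 hk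
  rw [exChar]
  generalize ‖k‖ = κ at *
  have h0 := mul_integral_abs_mul_add κ 0
  have h1 := mul_integral_abs_mul_add κ 2
  have h2 := mul_integral_abs_mul_add κ (-2)
  have h3 := mul_integral_abs_mul_add κ 4
  have h4 := mul_integral_abs_mul_add κ (-4)
  simp only [← sub_eq_add_neg, add_zero] at h0 h1 h2 h3 h4
  rw [intervalIntegral.integral_const_mul,
    intervalIntegral.integral_sub (Continuous.intervalIntegrable (by fun_prop) _ _)
      (Continuous.intervalIntegrable (by fun_prop) _ _),
    intervalIntegral.integral_sub (Continuous.intervalIntegrable (by fun_prop) _ _)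
      (Continuous.intervalIntegrable (by fun_prop) _ _),
    intervalIntegral.integral_add (Continuous.intervalIntegrable (by fun_prop) _ _)
      (Continuous.intervalIntegrable (by fun_prop) _ _),
    intervalIntegral.integral_add (Continuous.intervalIntegrable (by fun_prop) _ _)
      (Continuous.intervalIntegrable (by fun_prop) _ _)]
  simp only [intervalIntegral.integral_const_mul]
  refine mul_left_cancel₀ hpos.ne' ?_
  have hlhs : ∀ A B C D E : ℝ, κ * (4 / π * (π / 32 * (-6 * A + 4 * B + 4 * C - D - E))) =
      (-6 * (κ * A) + 4 * (κ * B) + 4 * (κ * C) - κ * D - κ * E) / 8 := by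
    intros
    field_simp
    ring
  rw [hlhs, h0, h1, h2, h3, h4, abs_of_pos hpos, abs_of_pos (by linarith : 0 < κ + 2),
    abs_of_pos (by linarith : 0 < κ + 4)]
  norm_num
  split_ifs with hk2 hk4
  · rw [abs_of_nonpos (by linarith : κ - 2 ≤ 0), abs_of_nonpos (by linarith : κ - 4 ≤ 0)]
    ring
  · rw [abs_of_nonneg (by linarith : 0 ≤ κ - 2), abs_of_nonpos (by linarith : κ - 4 ≤ 0)]
    field_simp
    ring
  · rw [abs_of_nonneg (by linarith : 0 ≤ κ - 2), abs_of_nonneg (by linarith : 0 ≤ κ - 4)]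
    ring

/-- Example 1: `α(x) = sin⁴(|x|)/(π²|x|⁴)` is a probability density on
`ℝ³`, and its Fourier transform equals `1 - 3|k|/8` for `|k| ≤ 2`,
`2/|k| - 1 + |k|/8` for `2 ≤ |k| ≤ 4`, and `0` for `|k| ≥ 4`. -/
theorem example_density_char :
    (∀ x : EuclideanSpace ℝ (Fin 3), 0 ≤ exDensity x) ∧
    (∫ x : EuclideanSpace ℝ (Fin 3), exDensity x) = 1 ∧
    ∀ k : EuclideanSpace ℝ (Fin 3),
      (∫ x : EuclideanSpace ℝ (Fin 3),
          Complex.exp (-(Complex.I * (⟪k, x⟫ : ℝ))) * (exDensity x : ℝ)) =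
        ((exChar k : ℝ) : ℂ) := by
  have hchar (k : EuclideanSpace ℝ (Fin 3)) :=
    (exDensity_char_eq_integral k).trans
      (congrArg Complex.ofReal (four_div_pi_mul_integral_eq_exChar k))
  refine ⟨fun x => by unfold exDensity; positivity, ?_, hchar⟩
  have h0 := hchar 0
  simp only [inner_zero_left, Complex.ofReal_zero, mul_zero, neg_zero, Complex.exp_zero, one_mul,
    integral_complex_ofReal, Complex.ofReal_inj] at h0
  simpa [exChar] using h0
end
end
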